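/- Ward identity for the single-site exponential: for every β > 0, every ε > 0, every L ≥ 2 and every site j ∈ Λ, ⟨e^{t_j}⟩ = 1. -/

import Mathlib

open scoped BigOperators Classical
open MeasureTheory

noncomputable section

/-- The 3-dimensional discrete torus of side `L`. -/
abbrev Torus (L : ℕ) := Fin 3 → ZMod L

/-- The unit vector in direction `i`. -/
def unitVec (L : ℕ) (i : Fin 3) : Torus L := fun j => if j = i then 1 else 0

/-- Nearest-neighbor relation on the torus. -/
def NN {L : ℕ} (x y : Torus L) : Prop :=
  x ≠ y ∧ ∃ i : Fin 3, y = x + unitVec L i ∨ y = x - unitVec L i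

/-- Periodic (Euclidean) distance on the torus. -/
def torusDist {L : ℕ} (x y : Torus L) : ℝ :=
  Real.sqrt (∑ i : Fin 3, (min ((x i - y i).val) (L - (x i - y i).val) : ℝ) ^ 2)

variable {L : ℕ}

/-- Sum of a (symmetric) function over unordered nearest-neighbor pairs. -/
def nnSum [NeZero L] (f : Torus L → Torus L → ℝ) : ℝ :=
  (1 / 2) * ∑ x : Torus L, ∑ y : Torus L, if NN x y then f x y else 0

/-- The matrix of the operator `D_{β,ε}(t)`, the symmetric operator on `ℝ^Λ` with
quadratic form `β ∑_{NN (ij)} e^{t_i+t_j}(v_i-v_j)² + ε ∑_k e^{t_k} v_k²`. -/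
def Dmat [NeZero L] (β ε : ℝ) (t : Torus L → ℝ) : Matrix (Torus L) (Torus L) ℝ :=
  Matrix.of fun j k =>
    if j = k then
      β * (∑ i : Torus L, if NN i j then Real.exp (t i + t j) else 0) + ε * Real.exp (t j)
    else if NN j k then -(β * Real.exp (t j + t k)) else 0

/-- The free energy (effective action) `F_{β,ε}(t)`. -/
def freeEnergy [NeZero L] (β ε : ℝ) (t : Torus L → ℝ) : ℝ :=
  β * nnSum (fun i j => Real.cosh (t i - t j) - 1)
    - (1 / 2) * Real.log (Dmat β ε t).det
    + ∑ k : Torus L, (t k - ε + ε * Real.cosh (t k))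

/-- The expectation `⟨f⟩ = ∫ f(t) e^{-F_{β,ε}(t)} ∏ dt_k/√(2π)`. -/
def expect [NeZero L] (β ε : ℝ) (f : (Torus L → ℝ) → ℝ) : ℝ :=
  ∫ t : Torus L → ℝ,
    f t * Real.exp (-(freeEnergy β ε t)) *
      ((Real.sqrt (2 * Real.pi))⁻¹) ^ (Fintype.card (Torus L))

lemma gauss_sinh (a : ℝ) (ha : 0 < a) :
    ∫⁻ v : ℝ, ENNReal.ofReal (2 * √a * Real.cosh v * Real.exp (-a * Real.cosh (2 * v)))
      = ENNReal.ofReal (√(2 * Real.pi) * Real.exp (-a)) := by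
  have hsa : 0 < √a := Real.sqrt_pos.2 ha
  have himg : (fun v => 2 * √a * Real.sinh v) '' Set.univ = Set.univ := by
    rw [Set.image_univ, Set.range_eq_univ]
    intro y
    obtain ⟨v, hv⟩ := Real.sinh_surjective (y / (2 * √a))
    refine ⟨v, ?_⟩
    simp only [hv]
    field_simp
  have hinj : Set.InjOn (fun v => 2 * √a * Real.sinh v) Set.univ := by
    intro x _ y _ h
    have : 2 * √a ≠ 0 := by positivity
    exact Real.sinh_injective (mul_left_cancel₀ this h)
  have key := lintegral_image_eq_lintegral_abs_deriv_mul (s := Set.univ)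
    (f := fun v => 2 * √a * Real.sinh v) (f' := fun v => 2 * √a * Real.cosh v)
    MeasurableSet.univ (fun x _ => ((Real.hasDerivAt_sinh x).const_mul (2 * √a)).hasDerivWithinAt)
    hinj (fun y => ENNReal.ofReal (Real.exp (-a) * Real.exp (-(1 / 2) * y ^ 2)))
  rw [himg, Measure.restrict_univ] at key
  have h1 : ∫⁻ y : ℝ, ENNReal.ofReal (Real.exp (-a) * Real.exp (-(1 / 2) * y ^ 2))
      = ENNReal.ofReal (√(2 * Real.pi) * Real.exp (-a)) := by
    rw [← ofReal_integral_eq_lintegral_ofReal]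
    · rw [integral_const_mul, integral_gaussian, mul_comm]
      congr 3
      ring
    · exact (integrable_exp_neg_mul_sq (by norm_num)).const_mul _
    · exact Filter.Eventually.of_forall fun x => by positivity
  rw [← h1, key]
  refine lintegral_congr fun v => ?_
  have hc := Real.cosh_pos v
  rw [← ENNReal.ofReal_mul (abs_nonneg _), abs_of_pos (by positivity), ← Real.exp_add]
  congr 3
  have h2 : Real.cosh (2 * v) = 1 + 2 * Real.sinh v ^ 2 := by
    rw [Real.cosh_two_mul, Real.cosh_sq]; ring
  rw [h2, mul_pow, mul_pow, Real.sq_sqrt ha.le]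
  ring

lemma exp_cosh_int (a : ℝ) (ha : 0 < a) :
    (∫⁻ v : ℝ, ENNReal.ofReal (2 * √a * Real.exp v * Real.exp (-a * Real.cosh (2 * v)))
      = ENNReal.ofReal (√(2 * Real.pi) * Real.exp (-a))) ∧
    (∫⁻ v : ℝ, ENNReal.ofReal (2 * √a * Real.exp (-v) * Real.exp (-a * Real.cosh (2 * v)))
      = ENNReal.ofReal (√(2 * Real.pi) * Real.exp (-a))) := by
  set A := ∫⁻ v : ℝ, ENNReal.ofReal (2 * √a * Real.exp v * Real.exp (-a * Real.cosh (2 * v)))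
    with hA
  set B := ∫⁻ v : ℝ, ENNReal.ofReal (2 * √a * Real.exp (-v) * Real.exp (-a * Real.cosh (2 * v)))
    with hB
  have hAB : B = A := by
    rw [hA, ← lintegral_neg_eq_self]
    refine lintegral_congr fun v => ?_
    rw [mul_neg, Real.cosh_neg]
  have hsum : A + B = 2 * ENNReal.ofReal (√(2 * Real.pi) * Real.exp (-a)) := by
    rw [← gauss_sinh a ha, hA, hB, ← lintegral_add_left (by fun_prop), ← lintegral_const_mul _ (by fun_prop)]
    refine lintegral_congr fun v => ?_
    rw [← ENNReal.ofReal_add (by positivity) (by positivity), ← ENNReal.ofReal_ofNat 2,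
      ← ENNReal.ofReal_mul (by norm_num), Real.cosh_eq v]
    congr 1
    ring
  have hA2 : A = ENNReal.ofReal (√(2 * Real.pi) * Real.exp (-a)) := by
    rw [hAB, ← two_mul] at hsum
    exact (ENNReal.mul_right_inj (by norm_num) (by norm_num)).1 hsum
  exact ⟨hA2, hAB.trans hA2⟩

lemma inv_gauss_subst (a : ℝ) (ha : 0 < a) (g : ℝ → ENNReal) :
    ∫⁻ s in Set.Ioi (0 : ℝ), g s =
      ∫⁻ v : ℝ, ENNReal.ofReal (2 * a * Real.exp (2 * v)) * g (a * Real.exp (2 * v)) := by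
  have himg : (fun v => a * Real.exp (2 * v)) '' Set.univ = Set.Ioi 0 := by
    ext y
    simp only [Set.image_univ, Set.mem_range, Set.mem_Ioi]
    constructor
    · rintro ⟨v, rfl⟩; positivity
    · intro hy
      refine ⟨Real.log (y / a) / 2, ?_⟩
      rw [mul_div_cancel₀ _ (by norm_num : (2 : ℝ) ≠ 0), Real.exp_log (by positivity)]
      field_simp
  have hinj : Set.InjOn (fun v => a * Real.exp (2 * v)) Set.univ := by
    intro x _ y _ h
    have := Real.exp_injective (mul_left_cancel₀ ha.ne' h)
    linarith
  have key := lintegral_image_eq_lintegral_abs_deriv_mul (s := Set.univ)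
    (f := fun v => a * Real.exp (2 * v)) (f' := fun v => 2 * a * Real.exp (2 * v))
    MeasurableSet.univ (fun x _ => by
      have h := (((hasDerivAt_id x).const_mul 2).exp.const_mul a).hasDerivWithinAt (s := Set.univ)
      have h2 : a * (Real.exp (2 * id x) * (2 * 1)) = 2 * a * Real.exp (2 * x) := by
        simp only [id]; ring
      rw [h2] at h
      exact h)
    hinj g
  rw [himg, Measure.restrict_univ] at key
  rw [key]
  refine lintegral_congr fun v => ?_
  rw [abs_of_pos (by positivity)]

lemma inv_gauss (a : ℝ) (ha : 0 < a) :
    (∫⁻ s in Set.Ioi (0 : ℝ), ENNReal.ofReal (Real.exp (-(1 / 2) * (s + a ^ 2 / s)) / √s)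
      = ENNReal.ofReal (√(2 * Real.pi) * Real.exp (-a))) ∧
    (∫⁻ s in Set.Ioi (0 : ℝ), ENNReal.ofReal (Real.exp (-(1 / 2) * (s + a ^ 2 / s)) / √s * (a / s))
      = ENNReal.ofReal (√(2 * Real.pi) * Real.exp (-a))) := by
  have hsa : 0 < √a := Real.sqrt_pos.2 ha
  have hs2 : √a ^ 2 = a := Real.sq_sqrt ha.le
  have e1 : ∀ v : ℝ, √(a * Real.exp (2 * v)) = √a * Real.exp v := by
    intro v
    rw [Real.sqrt_mul ha.le, two_mul, Real.exp_add, Real.sqrt_mul_self (Real.exp_pos v).le]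
  have e2 : ∀ v : ℝ, Real.exp (2 * v) = Real.exp v ^ 2 := by
    intro v; rw [two_mul, Real.exp_add, sq]
  have e3 : ∀ v : ℝ, -(1 / 2) * (a * Real.exp (2 * v) + a ^ 2 / (a * Real.exp (2 * v)))
      = -a * Real.cosh (2 * v) := by
    intro v
    rw [Real.cosh_eq, Real.exp_neg]
    field_simp
  constructor
  · rw [inv_gauss_subst a ha, ← (exp_cosh_int a ha).1]
    refine lintegral_congr fun v => ?_
    rw [← ENNReal.ofReal_mul (by positivity), e3, e1, e2]
    congr 1
    field_simp
    rw [hs2]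
  · rw [inv_gauss_subst a ha, ← (exp_cosh_int a ha).2]
    refine lintegral_congr fun v => ?_
    rw [← ENNReal.ofReal_mul (by positivity), e3, e1, e2, Real.exp_neg]
    congr 1
    field_simp
    rw [hs2]

open Matrix in
/-- The Schrödinger-type matrix `diag b - W`. -/
def HM {ι : Type*} [DecidableEq ι] (W : Matrix ι ι ℝ) (b : ι → ℝ) : Matrix ι ι ℝ :=
  Matrix.diagonal b - W

open Matrix in
/-- The density of the random potential. -/
def wt {ι : Type*} [Fintype ι] [DecidableEq ι] (W : Matrix ι ι ℝ) (η b : ι → ℝ) : ℝ :=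
  Real.exp (-(1 / 2) * ((∑ i, (b i - ∑ k, W i k)) + η ⬝ᵥ ((HM W b)⁻¹ *ᵥ η) - 2 * ∑ i, η i))
    / √(HM W b).det

/-- The set of potentials with positive definite Schrödinger matrix. -/
def pdset {ι : Type*} [DecidableEq ι] (W : Matrix ι ι ℝ) : Set (ι → ℝ) :=
  {b | (HM W b).PosDef}

section general
open Matrix
variable {ι : Type*} [Fintype ι] [DecidableEq ι]

lemma HM_mulVec (W : Matrix ι ι ℝ) (b x : ι → ℝ) (i : ι) :
    (HM W b *ᵥ x) i = b i * x i - ∑ k, W i k * x k := by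
  rw [HM, sub_mulVec, Pi.sub_apply, mulVec_diagonal]
  rfl

lemma HM_herm (W : Matrix ι ι ℝ) (hW : W.IsSymm) (b : ι → ℝ) : (HM W b).IsHermitian := by
  unfold HM
  apply IsHermitian.sub
  · exact isHermitian_diagonal b
  · unfold IsHermitian
    rw [conjTranspose_eq_transpose_of_trivial, hW]

lemma HM_symm (W : Matrix ι ι ℝ) (hW : W.IsSymm) (b : ι → ℝ) : (HM W b).IsSymm := by
  have := HM_herm W hW b
  unfold IsHermitian at this
  rwa [conjTranspose_eq_transpose_of_trivial] at this

lemma symm_dot {M : Matrix ι ι ℝ} (hM : M.IsSymm) (x y : ι → ℝ) :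
    x ⬝ᵥ (M *ᵥ y) = y ⬝ᵥ (M *ᵥ x) := by
  rw [dotProduct_mulVec, ← mulVec_transpose, hM, dotProduct_comm]

lemma pd_mul_inv {M : Matrix ι ι ℝ} (hM : M.PosDef) (x : ι → ℝ) : M *ᵥ (M⁻¹ *ᵥ x) = x := by
  rw [mulVec_mulVec, mul_nonsing_inv _ (isUnit_iff_ne_zero.2 hM.det_pos.ne'), one_mulVec]

lemma pd_inv_eq {M : Matrix ι ι ℝ} (hM : M.PosDef) {x y : ι → ℝ} (h : M *ᵥ x = y) :
    M⁻¹ *ᵥ y = x := by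
  rw [← h, mulVec_mulVec, nonsing_inv_mul _ (isUnit_iff_ne_zero.2 hM.det_pos.ne'), one_mulVec]

lemma mmatrix_nonneg (W : Matrix ι ι ℝ) (hW : ∀ i k, 0 ≤ W i k) (b η : ι → ℝ)
    (hη : ∀ i, 0 ≤ η i) (hpd : (HM W b).PosDef) (x : ι → ℝ) (hx : HM W b *ᵥ x = η) (i : ι) :
    0 ≤ x i := by
  set m : ι → ℝ := fun i => max (-x i) 0 with hm
  have hm0 : ∀ i, 0 ≤ m i := fun i => le_max_right _ _
  have hp0 : ∀ i, 0 ≤ x i + m i := fun i => by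
    have := le_max_left (-x i) 0
    simp only [hm]; linarith
  have hmp : ∀ i, m i * (x i + m i) = 0 := fun i => by
    simp only [hm]
    rcases le_total 0 (-x i) with h | h
    · rw [max_eq_left h]; ring
    · rw [max_eq_right h]; ring
  have hmz : m = 0 := by
    by_contra hne
    have h1 := hpd.dotProduct_mulVec_pos hne
    rw [star_trivial] at h1
    have h2 : m ⬝ᵥ (HM W b *ᵥ m) = m ⬝ᵥ (HM W b *ᵥ (x + m)) - m ⬝ᵥ η := by
      rw [mulVec_add, hx, dotProduct_add]; ring
    have h3 : 0 ≤ m ⬝ᵥ η := Finset.sum_nonneg fun i _ => mul_nonneg (hm0 i) (hη i)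
    have h4 : m ⬝ᵥ (HM W b *ᵥ (x + m)) ≤ 0 := by
      refine Finset.sum_nonpos fun i _ => ?_
      rw [HM_mulVec, mul_sub]
      have : m i * (b i * (x + m) i) = 0 := by
        rw [mul_left_comm, Pi.add_apply, hmp, mul_zero]
      rw [this]
      have := mul_nonneg (hm0 i) (Finset.sum_nonneg fun k (_ : k ∈ Finset.univ) =>
        mul_nonneg (hW i k) (hp0 k))
      simp only [Pi.add_apply]
      linarith
    linarith
  have := congrFun hmz i
  simp only [hm, Pi.zero_apply] at this
  have h5 := le_max_left (-x i) 0
  linarith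

lemma mmatrix_pos (W : Matrix ι ι ℝ) (hW : ∀ i k, 0 ≤ W i k) (b η : ι → ℝ)
    (hη : ∀ i, 0 < η i) (hpd : (HM W b).PosDef) (x : ι → ℝ) (hx : HM W b *ᵥ x = η) (i : ι) :
    0 < x i := by
  have h0 := mmatrix_nonneg W hW b η (fun i => (hη i).le) hpd x hx
  refine lt_of_le_of_ne (h0 i) fun h => ?_
  have h1 := congrFun hx i
  rw [HM_mulVec, ← h] at h1
  have := Finset.sum_nonneg fun k (_ : k ∈ Finset.univ) => mul_nonneg (hW i k) (h0 k)
  have := hη i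
  linarith

lemma HM_continuous (W : Matrix ι ι ℝ) : Continuous (fun b => HM W b) := by
  unfold HM; fun_prop

lemma pdset_meas (W : Matrix ι ι ℝ) (hW : W.IsSymm) : MeasurableSet (pdset W) := by
  have h : pdset W = (⋂ x : ι → ℝ, {b | 0 ≤ x ⬝ᵥ (HM W b *ᵥ x)}) ∩ {b | (HM W b).det ≠ 0} := by
    ext b
    simp only [pdset, Set.mem_ofPred_eq, Set.mem_inter_iff, Set.mem_iInter]
    constructor
    · intro h
      exact ⟨fun x => by simpa using h.posSemidef.dotProduct_mulVec_nonneg x, h.det_pos.ne'⟩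
    · rintro ⟨h1, h2⟩
      have h3 : (HM W b).PosSemidef :=
        PosSemidef.of_dotProduct_mulVec_nonneg (HM_herm W hW b) (fun x => by simpa using h1 x)
      exact h3.posDef_iff_det_ne_zero.2 h2
  have hc := HM_continuous W
  rw [h]
  refine MeasurableSet.inter ?_ ?_
  · refine IsClosed.measurableSet (isClosed_iInter fun x => isClosed_le continuous_const ?_)
    fun_prop
  · exact (isOpen_ne_fun (by fun_prop) continuous_const).measurableSet

lemma HM_inv_meas (W : Matrix ι ι ℝ) (η : ι → ℝ) (i : ι) :
    Measurable (fun b => ((HM W b)⁻¹ *ᵥ η) i) := by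
  have hc := HM_continuous W
  have : (fun b => ((HM W b)⁻¹ *ᵥ η) i) =
      fun b => ((HM W b).det)⁻¹ * (((HM W b).adjugate) *ᵥ η) i := by
    ext b
    rw [Matrix.inv_def, Ring.inverse_eq_inv', smul_mulVec]
    rfl
  rw [this]
  refine Measurable.mul ?_ ?_
  · exact (Continuous.measurable (by fun_prop)).inv
  · refine Continuous.measurable ?_
    have : Continuous fun b => ((HM W b).adjugate) *ᵥ η := by fun_prop
    exact (continuous_apply i).comp this

lemma wt_meas (W : Matrix ι ι ℝ) (η : ι → ℝ) : Measurable (wt W η) := by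
  have hc := HM_continuous W
  unfold wt
  refine Measurable.div ?_ ?_
  · refine Real.measurable_exp.comp (Measurable.const_mul ?_ _)
    refine Measurable.sub (Measurable.add ?_ ?_) measurable_const
    · fun_prop
    · unfold dotProduct
      exact Finset.measurable_sum _ fun i _ => (HM_inv_meas W η i).const_mul _
  · exact (Continuous.measurable (by fun_prop)).sqrt

lemma wt_nonneg (W : Matrix ι ι ℝ) (η b : ι → ℝ) : 0 ≤ wt W η b := by
  unfold wt; positivity

end general

section schur
open Matrix
variable {n : ℕ}

/-- Lower right block. -/
def Wt (W : Matrix (Fin (n + 1)) (Fin (n + 1)) ℝ) : Matrix (Fin n) (Fin n) ℝ :=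
  W.submatrix Fin.succ Fin.succ

/-- First row off the diagonal. -/
def wr (W : Matrix (Fin (n + 1)) (Fin (n + 1)) ℝ) : Fin n → ℝ := fun i => W 0 i.succ

lemma Wt_symm {W : Matrix (Fin (n + 1)) (Fin (n + 1)) ℝ} (hW : W.IsSymm) : (Wt W).IsSymm :=
  hW.submatrix _

lemma HM_sub (W : Matrix (Fin (n + 1)) (Fin (n + 1)) ℝ) (b0 : ℝ) (b : Fin n → ℝ) :
    (HM W (Fin.cons b0 b)).submatrix Fin.succ Fin.succ = HM (Wt W) b := by
  ext i k
  simp [HM, Wt, diagonal_apply]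

lemma HM_cons (W : Matrix (Fin (n + 1)) (Fin (n + 1)) ℝ) (hW : W.IsSymm)
    (b0 x0 : ℝ) (b x : Fin n → ℝ) :
    HM W (Fin.cons b0 b) *ᵥ (Fin.cons x0 x : Fin (n + 1) → ℝ) =
      Fin.cons ((b0 - W 0 0) * x0 - wr W ⬝ᵥ x) (HM (Wt W) b *ᵥ x - x0 • wr W) := by
  ext i
  rw [HM_mulVec, Fin.sum_univ_succ]
  refine Fin.cases ?_ (fun i => ?_) i
  · simp only [Fin.cons_zero, Fin.cons_succ, wr, dotProduct]
    ring
  · simp only [Fin.cons_zero, Fin.cons_succ, wr, Pi.sub_apply, HM_mulVec, Pi.smul_apply,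
      smul_eq_mul, Wt, submatrix_apply]
    rw [hW.apply]
    ring

lemma cons_dot (x0 y0 : ℝ) (x y : Fin n → ℝ) :
    (Fin.cons x0 x : Fin (n + 1) → ℝ) ⬝ᵥ (Fin.cons y0 y : Fin (n + 1) → ℝ) = x0 * y0 + x ⬝ᵥ y := by
  simp [dotProduct, Fin.sum_univ_succ]

lemma quad_cons (W : Matrix (Fin (n + 1)) (Fin (n + 1)) ℝ) (hW : W.IsSymm)
    (b0 x0 : ℝ) (b x : Fin n → ℝ) (hpd : (HM (Wt W) b).PosDef) :
    (Fin.cons x0 x : Fin (n + 1) → ℝ) ⬝ᵥ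
      (HM W (Fin.cons b0 b) *ᵥ (Fin.cons x0 x : Fin (n + 1) → ℝ)) =
      (b0 - W 0 0 - wr W ⬝ᵥ ((HM (Wt W) b)⁻¹ *ᵥ wr W)) * x0 ^ 2 +
      (x - x0 • ((HM (Wt W) b)⁻¹ *ᵥ wr W)) ⬝ᵥ
        (HM (Wt W) b *ᵥ (x - x0 • ((HM (Wt W) b)⁻¹ *ᵥ wr W))) := by
  rw [HM_cons W hW, cons_dot]
  set u := (HM (Wt W) b)⁻¹ *ᵥ wr W with hu
  have h1 : HM (Wt W) b *ᵥ u = wr W := pd_mul_inv hpd _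
  have h2 : u ⬝ᵥ (HM (Wt W) b *ᵥ x) = wr W ⬝ᵥ x := by
    rw [symm_dot (HM_symm _ (Wt_symm hW) b), h1, dotProduct_comm]
  simp only [mulVec_sub, mulVec_smul, h1, dotProduct_sub, sub_dotProduct, dotProduct_smul,
    smul_dotProduct, smul_eq_mul, h2, dotProduct_comm x (wr W), dotProduct_comm u (wr W)]
  ring

lemma pd_sub (W : Matrix (Fin (n + 1)) (Fin (n + 1)) ℝ)
    (b0 : ℝ) (b : Fin n → ℝ) (h : (HM W (Fin.cons b0 b)).PosDef) : (HM (Wt W) b).PosDef := by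
  rw [← HM_sub W b0]
  exact h.submatrix (Fin.succ_injective n)

lemma pd_iff (W : Matrix (Fin (n + 1)) (Fin (n + 1)) ℝ) (hW : W.IsSymm)
    (b0 : ℝ) (b : Fin n → ℝ) (hpd : (HM (Wt W) b).PosDef) :
    (HM W (Fin.cons b0 b)).PosDef ↔
      0 < b0 - W 0 0 - wr W ⬝ᵥ ((HM (Wt W) b)⁻¹ *ᵥ wr W) := by
  constructor
  · intro h
    have h1 : (Fin.cons 1 ((HM (Wt W) b)⁻¹ *ᵥ wr W) : Fin (n + 1) → ℝ) ≠ 0 := by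
      intro h0
      have := congrFun h0 0
      simp at this
    have h2 := h.dotProduct_mulVec_pos h1
    rw [star_trivial, quad_cons W hW _ _ _ _ hpd] at h2
    simpa using h2
  · intro hs
    refine PosDef.of_dotProduct_mulVec_pos (HM_herm W hW _) fun {x} hx => ?_
    rw [star_trivial, ← Fin.cons_self_tail x, quad_cons W hW _ _ _ _ hpd]
    by_cases h0 : x 0 = 0
    · have ht : Fin.tail x ≠ 0 := by
        intro ht
        apply hx
        rw [← Fin.cons_self_tail x, ht, h0]
        ext i
        refine Fin.cases ?_ (fun i => ?_) i <;> simp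
      have := hpd.dotProduct_mulVec_pos ht
      rw [star_trivial] at this
      simpa [h0] using this
    · have h3 := hpd.posSemidef.dotProduct_mulVec_nonneg
        (Fin.tail x - x 0 • ((HM (Wt W) b)⁻¹ *ᵥ wr W))
      rw [star_trivial] at h3
      have : 0 < x 0 ^ 2 := by positivity
      have := mul_pos hs this
      linarith

/-- Solution of the linear system with the Schur complement. -/
lemma schur_solve (W : Matrix (Fin (n + 1)) (Fin (n + 1)) ℝ) (hW : W.IsSymm)
    (b0 η0 s a : ℝ) (b η : Fin n → ℝ) (hpd : (HM (Wt W) b).PosDef)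
    (hs : s = b0 - W 0 0 - wr W ⬝ᵥ ((HM (Wt W) b)⁻¹ *ᵥ wr W)) (hs0 : s ≠ 0)
    (ha : a = η0 + wr W ⬝ᵥ ((HM (Wt W) b)⁻¹ *ᵥ η)) :
    HM W (Fin.cons b0 b) *ᵥ (Fin.cons (a / s) ((HM (Wt W) b)⁻¹ *ᵥ η +
      (a / s) • ((HM (Wt W) b)⁻¹ *ᵥ wr W)) : Fin (n + 1) → ℝ) = Fin.cons η0 η := by
  rw [HM_cons W hW]
  congr 1
  · rw [dotProduct_add, dotProduct_smul, smul_eq_mul]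
    have h1 : wr W ⬝ᵥ ((HM (Wt W) b)⁻¹ *ᵥ η) = a - η0 := by rw [ha]; ring
    have h2 : wr W ⬝ᵥ ((HM (Wt W) b)⁻¹ *ᵥ wr W) = b0 - W 0 0 - s := by rw [hs]; ring
    rw [h1, h2]
    field_simp
    ring
  · rw [mulVec_add, mulVec_smul, pd_mul_inv hpd, pd_mul_inv hpd]
    simp

lemma schur_det (W : Matrix (Fin (n + 1)) (Fin (n + 1)) ℝ) (hW : W.IsSymm)
    (b0 s : ℝ) (b : Fin n → ℝ) (hpd : (HM (Wt W) b).PosDef)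
    (hs : s = b0 - W 0 0 - wr W ⬝ᵥ ((HM (Wt W) b)⁻¹ *ᵥ wr W)) (hs0 : s ≠ 0) :
    (HM W (Fin.cons b0 b)).det = s * (HM (Wt W) b).det := by
  have h := schur_solve W hW b0 1 s 1 b 0 hpd hs hs0 (by simp)
  have h2 := congrArg (fun v => ((HM W (Fin.cons b0 b)).adjugate *ᵥ v) 0) h
  simp only [mulVec_mulVec, adjugate_mul, smul_mulVec, one_mulVec, Pi.smul_apply, Fin.cons_zero,
    smul_eq_mul] at h2
  have h3 : ((HM W (Fin.cons b0 b)).adjugate *ᵥ (Fin.cons 1 0 : Fin (n + 1) → ℝ)) 0 =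
      (HM (Wt W) b).det := by
    rw [mulVec, dotProduct, Fin.sum_univ_succ]
    simp only [Fin.cons_zero, Fin.cons_succ, Pi.zero_apply, mul_zero, Finset.sum_const_zero,
      add_zero, mul_one]
    rw [adjugate_fin_succ_eq_det_submatrix]
    have : ((0 : Fin (n + 1)).succAbove) = Fin.succ := by ext i; simp
    rw [this, HM_sub]
    simp
  rw [h3] at h2
  rw [← h2]
  field_simp

lemma schur_wt (W : Matrix (Fin (n + 1)) (Fin (n + 1)) ℝ) (hW : W.IsSymm)
    (b0 η0 s a : ℝ) (b η : Fin n → ℝ) (hpd : (HM (Wt W) b).PosDef)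
    (hs : s = b0 - W 0 0 - wr W ⬝ᵥ ((HM (Wt W) b)⁻¹ *ᵥ wr W)) (hs0 : 0 < s)
    (ha : a = η0 + wr W ⬝ᵥ ((HM (Wt W) b)⁻¹ *ᵥ η)) :
    wt W (Fin.cons η0 η) (Fin.cons b0 b) =
      Real.exp a * wt (Wt W) (η + wr W) b * (Real.exp (-(1 / 2) * (s + a ^ 2 / s)) / √s) ∧
    ((HM W (Fin.cons b0 b))⁻¹ *ᵥ (Fin.cons η0 η : Fin (n + 1) → ℝ)) 0 = a / s := by
  have hpd2 : (HM W (Fin.cons b0 b)).PosDef := by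
    rw [pd_iff W hW b0 b hpd, ← hs]; exact hs0
  have hsol := pd_inv_eq hpd2 (schur_solve W hW b0 η0 s a b η hpd hs hs0.ne' ha)
  refine ⟨?_, by rw [hsol]; rfl⟩
  unfold wt
  rw [hsol, schur_det W hW b0 s b hpd hs hs0.ne', Real.sqrt_mul hs0.le, cons_dot]
  have hd : 0 < √(HM (Wt W) b).det := Real.sqrt_pos.2 hpd.det_pos
  have hsq : 0 < √s := Real.sqrt_pos.2 hs0
  have hexp : ∀ X Y Z V : ℝ, X = Y + Z + V → Real.exp X / (√s * √(HM (Wt W) b).det) =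
      Real.exp Y * (Real.exp Z / √(HM (Wt W) b).det) * (Real.exp V / √s) := by
    rintro X Y Z V rfl
    rw [Real.exp_add, Real.exp_add]
    field_simp
  apply hexp
  have hinv : (HM (Wt W) b)⁻¹.IsSymm := by
    unfold IsSymm
    rw [transpose_nonsing_inv, HM_symm _ (Wt_symm hW) b]
  have hsw : η ⬝ᵥ ((HM (Wt W) b)⁻¹ *ᵥ wr W) = a - η0 := by
    rw [symm_dot hinv, ha]; ring
  have hww : wr W ⬝ᵥ ((HM (Wt W) b)⁻¹ *ᵥ wr W) = b0 - W 0 0 - s := by rw [hs]; ring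
  have hwe : wr W ⬝ᵥ ((HM (Wt W) b)⁻¹ *ᵥ η) = a - η0 := by rw [ha]; ring
  simp only [Fin.sum_univ_succ, Fin.cons_zero, Fin.cons_succ, mulVec_add, dotProduct_add,
    add_dotProduct, dotProduct_smul, smul_eq_mul, hsw, hww, hwe, Pi.add_apply,
    Finset.sum_add_distrib, Finset.sum_sub_distrib]
  have hr : ∑ i : Fin n, W i.succ 0 = ∑ i, wr W i :=
    Finset.sum_congr rfl fun i _ => hW.apply _ _
  have hr2 : ∑ i : Fin n, W 0 i.succ = ∑ i, wr W i := rfl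
  rw [hr, hr2]
  simp only [Wt, submatrix_apply]
  field_simp
  ring

end schur

section induct
open Matrix
variable {n : ℕ}

lemma inner_int (W : Matrix (Fin (n + 1)) (Fin (n + 1)) ℝ) (hW : W.IsSymm)
    (hW0 : ∀ i k, 0 ≤ W i k) (η0 : ℝ) (η : Fin n → ℝ) (hη0 : 0 < η0) (hη : ∀ i, 0 < η i)
    (b : Fin n → ℝ) :
    (∫⁻ b0 : ℝ, (pdset W).indicator
        (fun b => ENNReal.ofReal (wt W (Fin.cons η0 η) b)) (Fin.cons b0 b)
      = ENNReal.ofReal √(2 * Real.pi) * (pdset (Wt W)).indicator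
        (fun b => ENNReal.ofReal (wt (Wt W) (η + wr W) b)) b) ∧
    (∫⁻ b0 : ℝ, (pdset W).indicator
        (fun b => ENNReal.ofReal (wt W (Fin.cons η0 η) b *
          ((HM W b)⁻¹ *ᵥ (Fin.cons η0 η : Fin (n + 1) → ℝ)) 0)) (Fin.cons b0 b)
      = ENNReal.ofReal √(2 * Real.pi) * (pdset (Wt W)).indicator
        (fun b => ENNReal.ofReal (wt (Wt W) (η + wr W) b)) b) := by
  by_cases hpd : (HM (Wt W) b).PosDef
  swap
  · have h1 : ∀ b0 : ℝ, (Fin.cons b0 b : Fin (n + 1) → ℝ) ∉ pdset W :=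
      fun b0 h => hpd (pd_sub W b0 b h)
    have h2 : b ∉ pdset (Wt W) := hpd
    simp [h1, h2]
  set c := W 0 0 + wr W ⬝ᵥ ((HM (Wt W) b)⁻¹ *ᵥ wr W) with hc
  set a := η0 + wr W ⬝ᵥ ((HM (Wt W) b)⁻¹ *ᵥ η) with ha
  have hapos : 0 < a := by
    have : 0 ≤ wr W ⬝ᵥ ((HM (Wt W) b)⁻¹ *ᵥ η) :=
      Finset.sum_nonneg fun i _ => mul_nonneg (hW0 _ _)
        (mmatrix_nonneg (Wt W) (fun i k => hW0 _ _) b η (fun i => (hη i).le) hpd _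
          (pd_mul_inv hpd η) i)
    linarith
  have hb : b ∈ pdset (Wt W) := hpd
  rw [Set.indicator_of_mem hb]
  have hscal : ENNReal.ofReal √(2 * Real.pi) * ENNReal.ofReal (wt (Wt W) (η + wr W) b)
      = ENNReal.ofReal (Real.exp a * wt (Wt W) (η + wr W) b) *
        ENNReal.ofReal (√(2 * Real.pi) * Real.exp (-a)) := by
    have := wt_nonneg (Wt W) (η + wr W) b
    rw [← ENNReal.ofReal_mul (by positivity), ← ENNReal.ofReal_mul (by positivity)]
    congr 1
    rw [Real.exp_neg]
    field_simp
  have hmem : ∀ s : ℝ, (Fin.cons (s + c) b : Fin (n + 1) → ℝ) ∈ pdset W ↔ s ∈ Set.Ioi (0 : ℝ) := by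
    intro s
    have : s = s + c - W 0 0 - wr W ⬝ᵥ ((HM (Wt W) b)⁻¹ *ᵥ wr W) := by rw [hc]; ring
    simp only [pdset, Set.mem_ofPred_eq, pd_iff W hW _ b hpd, Set.mem_Ioi]
    rw [← this]
  have hC : 0 ≤ Real.exp a * wt (Wt W) (η + wr W) b :=
    mul_nonneg (Real.exp_pos a).le (wt_nonneg _ _ _)
  constructor
  · rw [hscal, ← (inv_gauss a hapos).1, ← lintegral_const_mul _ (by fun_prop),
      ← lintegral_indicator measurableSet_Ioi, ← lintegral_add_right_eq_self _ c]
    refine lintegral_congr fun s => ?_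
    by_cases hs : s ∈ Set.Ioi (0 : ℝ)
    · rw [Set.indicator_of_mem ((hmem s).2 hs), Set.indicator_of_mem hs, ← ENNReal.ofReal_mul hC,
        (schur_wt W hW (s + c) η0 s a b η hpd (by rw [hc]; ring) hs ha).1]
    · rw [Set.indicator_of_notMem (fun h => hs ((hmem s).1 h)), Set.indicator_of_notMem hs]
  · rw [hscal, ← (inv_gauss a hapos).2, ← lintegral_const_mul _ (by fun_prop),
      ← lintegral_indicator measurableSet_Ioi, ← lintegral_add_right_eq_self _ c]
    refine lintegral_congr fun s => ?_
    by_cases hs : s ∈ Set.Ioi (0 : ℝ)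
    · rw [Set.indicator_of_mem ((hmem s).2 hs), Set.indicator_of_mem hs, ← ENNReal.ofReal_mul hC,
        (schur_wt W hW (s + c) η0 s a b η hpd (by rw [hc]; ring) hs ha).1,
        (schur_wt W hW (s + c) η0 s a b η hpd (by rw [hc]; ring) hs ha).2, mul_assoc]
    · rw [Set.indicator_of_notMem (fun h => hs ((hmem s).1 h)), Set.indicator_of_notMem hs]

lemma lintegral_cons (f : (Fin (n + 1) → ℝ) → ENNReal) (hf : Measurable f) :
    ∫⁻ b, f b = ∫⁻ b : Fin n → ℝ, ∫⁻ b0 : ℝ, f (Fin.cons b0 b) := by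
  have h := (volume_preserving_piFinSuccAbove (fun _ : Fin (n + 1) => ℝ) 0).symm
  rw [← h.lintegral_comp_emb (MeasurableEquiv.measurableEmbedding _), Measure.volume_eq_prod,
    lintegral_prod_symm' (fun a => f ((MeasurableEquiv.piFinSuccAbove (fun _ => ℝ) 0).symm a))
      (hf.comp (MeasurableEquiv.measurable _))]
  refine lintegral_congr fun b => lintegral_congr fun b0 => ?_
  congr 1
  simp [MeasurableEquiv.piFinSuccAbove, Fin.insertNthEquiv]

lemma norm_int : ∀ (n : ℕ) (W : Matrix (Fin n) (Fin n) ℝ) (_ : W.IsSymm)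
    (_ : ∀ i k, 0 ≤ W i k) (η : Fin n → ℝ) (_ : ∀ i, 0 < η i),
    ∫⁻ b, (pdset W).indicator (fun b => ENNReal.ofReal (wt W η b)) b
      = ENNReal.ofReal √(2 * Real.pi) ^ n := by
  intro n
  induction n with
  | zero =>
    intro W hW hW0 η hη
    have h1 : ∀ b, (pdset W).indicator (fun b => ENNReal.ofReal (wt W η b)) b = 1 := by
      intro b
      have : b ∈ pdset W :=
        PosDef.of_dotProduct_mulVec_pos (HM_herm W hW _)
          fun {x} hx => (hx (Subsingleton.elim _ _)).elim
      rw [Set.indicator_of_mem this]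
      simp [wt]
    simp only [h1, lintegral_const, one_mul, pow_zero]
    rw [volume_pi, Measure.pi_of_empty]
    simp
  | succ n ih =>
    intro W hW hW0 η hη
    rw [lintegral_cons _ ((wt_meas W η).ennreal_ofReal.indicator (pdset_meas W hW)),
      ← Fin.cons_self_tail η]
    rw [lintegral_congr fun b => (inner_int W hW hW0 (η 0) (Fin.tail η) (hη 0)
      (fun i => hη _) b).1]
    rw [lintegral_const_mul _ ((wt_meas _ _).ennreal_ofReal.indicator (pdset_meas _ (Wt_symm hW))),
      ih (Wt W) (Wt_symm hW) (fun i k => hW0 _ _) (Fin.tail η + wr W)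
        (fun i => add_pos_of_pos_of_nonneg (hη _) (hW0 _ _)), pow_succ, mul_comm]

lemma ward_fin (W : Matrix (Fin (n + 1)) (Fin (n + 1)) ℝ) (hW : W.IsSymm)
    (hW0 : ∀ i k, 0 ≤ W i k) (η : Fin (n + 1) → ℝ) (hη : ∀ i, 0 < η i) :
    ∫⁻ b, (pdset W).indicator (fun b => ENNReal.ofReal (wt W η b * ((HM W b)⁻¹ *ᵥ η) 0)) b
      = ENNReal.ofReal √(2 * Real.pi) ^ (n + 1) := by
  have hmeas : Measurable (fun b => wt W η b * ((HM W b)⁻¹ *ᵥ η) 0) :=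
    (wt_meas W η).mul (HM_inv_meas W η 0)
  rw [lintegral_cons _ (hmeas.ennreal_ofReal.indicator (pdset_meas W hW)), ← Fin.cons_self_tail η]
  rw [lintegral_congr fun b => (inner_int W hW hW0 (η 0) (Fin.tail η) (hη 0)
    (fun i => hη _) b).2]
  rw [lintegral_const_mul _ ((wt_meas _ _).ennreal_ofReal.indicator (pdset_meas _ (Wt_symm hW))),
    norm_int n (Wt W) (Wt_symm hW) (fun i k => hW0 _ _) (Fin.tail η + wr W)
      (fun i => add_pos_of_pos_of_nonneg (hη _) (hW0 _ _)), pow_succ, mul_comm]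

lemma ward_gen {ι : Type*} [Fintype ι] [DecidableEq ι] (W : Matrix ι ι ℝ) (hW : W.IsSymm)
    (hW0 : ∀ i k, 0 ≤ W i k) (η : ι → ℝ) (hη : ∀ i, 0 < η i) (j : ι) :
    ∫⁻ b, (pdset W).indicator (fun b => ENNReal.ofReal (wt W η b * ((HM W b)⁻¹ *ᵥ η) j)) b
      = ENNReal.ofReal √(2 * Real.pi) ^ (Fintype.card ι) := by
  obtain ⟨n, hn⟩ : ∃ n, Fintype.card ι = n + 1 :=
    Nat.exists_eq_succ_of_ne_zero (Fintype.card_pos_iff.2 ⟨j⟩).ne'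
  obtain ⟨e, he⟩ : ∃ e : Fin (n + 1) ≃ ι, e 0 = j := by
    let e0 := (Fintype.equivFinOfCardEq hn).symm
    exact ⟨e0.trans (Equiv.swap (e0 0) j), by simp⟩
  rw [hn, ← ward_fin (W.submatrix e e) (hW.submatrix e) (fun i k => hW0 _ _) (η ∘ e)
    (fun i => hη _)]
  have h := volume_measurePreserving_piCongrLeft (fun _ : ι => ℝ) e
  rw [← h.lintegral_comp_emb (MeasurableEquiv.measurableEmbedding _)]
  refine lintegral_congr fun b => ?_
  have hb : (MeasurableEquiv.piCongrLeft (fun _ : ι => ℝ) e) b = b ∘ e.symm := by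
    ext i
    obtain ⟨k, rfl⟩ := e.surjective i
    simp [MeasurableEquiv.piCongrLeft, Equiv.piCongrLeft_apply_apply]
  rw [hb]
  have hH : HM (W.submatrix e e) b = (HM W (b ∘ e.symm)).submatrix e e := by
    ext i k
    simp [HM, diagonal_apply]
  have hpd : b ∈ pdset (W.submatrix e e) ↔ b ∘ e.symm ∈ pdset W := by
    simp only [pdset, Set.mem_ofPred_eq, hH]
    constructor
    · intro h
      have := h.submatrix e.symm.injective
      simpa using this
    · intro h
      exact h.submatrix e.injective
  have hsol : (HM (W.submatrix e e) b)⁻¹ *ᵥ (η ∘ e) = ((HM W (b ∘ e.symm))⁻¹ *ᵥ η) ∘ e := by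
    rw [hH, inv_submatrix_equiv]
    ext i
    simp only [mulVec, dotProduct, submatrix_apply, Function.comp]
    exact e.sum_comp (fun k => (HM W (fun x => b (e.symm x)))⁻¹ (e i) k * η k)
  have hwt : wt (W.submatrix e e) (η ∘ e) b = wt W η (b ∘ e.symm) := by
    unfold wt
    rw [hsol, hH, det_submatrix_equiv_self]
    have h1 : ∑ i, (b i - ∑ k, (W.submatrix e e) i k)
        = ∑ i, ((b ∘ e.symm) i - ∑ k, W i k) := by
      rw [← e.sum_comp]
      refine Finset.sum_congr rfl fun i _ => ?_
      simp only [Function.comp, Equiv.symm_apply_apply, submatrix_apply]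
      rw [e.sum_comp (fun k => W (e i) k)]
    have h2 : (η ∘ e) ⬝ᵥ (((HM W (b ∘ e.symm))⁻¹ *ᵥ η) ∘ e) =
        η ⬝ᵥ ((HM W (b ∘ e.symm))⁻¹ *ᵥ η) :=
      e.sum_comp (fun k => η k * ((HM W (b ∘ e.symm))⁻¹ *ᵥ η) k)
    have h3 : ∑ i, (η ∘ e) i = ∑ i, η i := e.sum_comp η
    rw [h1, h2, h3]
  by_cases hm : b ∘ e.symm ∈ pdset W
  · rw [Set.indicator_of_mem hm, Set.indicator_of_mem (hpd.2 hm), hsol, hwt, Function.comp, he]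
  · rw [Set.indicator_of_notMem hm, Set.indicator_of_notMem (fun h => hm (hpd.1 h))]

end induct

section change
open Matrix
variable {ι : Type*} [Fintype ι] [DecidableEq ι]

/-- The change of variables from `t` to the potential. -/
def phi (W : Matrix ι ι ℝ) (η t : ι → ℝ) : ι → ℝ :=
  fun i => Real.exp (-t i) * (η i + ∑ k, W i k * Real.exp (t k))

/-- The Jacobian matrix of `phi`. -/
def Jm (W : Matrix ι ι ℝ) (η t : ι → ℝ) : Matrix ι ι ℝ :=
  -(diagonal (fun i => Real.exp (-t i)) * HM W (phi W η t) * diagonal (fun i => Real.exp (t i)))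

lemma phi_solve (W : Matrix ι ι ℝ) (η t : ι → ℝ) :
    HM W (phi W η t) *ᵥ (fun i => Real.exp (t i)) = η := by
  ext i
  rw [HM_mulVec, phi, Real.exp_neg]
  field_simp
  ring

lemma phi_pd (W : Matrix ι ι ℝ) (hW : W.IsSymm)
    (hW0 : ∀ i k, 0 ≤ W i k) (η : ι → ℝ) (hη : ∀ i, 0 < η i) (t : ι → ℝ) :
    (HM W (phi W η t)).PosDef := by
  refine PosDef.of_dotProduct_mulVec_pos (HM_herm W hW _) fun {x} hx => ?_
  rw [star_trivial]
  obtain ⟨i0, hi0⟩ := Function.ne_iff.1 hx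
  have h1 : x ⬝ᵥ (HM W (phi W η t) *ᵥ x) = ∑ i, η i * Real.exp (-t i) * x i ^ 2 +
      ∑ i, ∑ k, W i k * (Real.exp (-t i) * Real.exp (t k) * x i ^ 2 - x i * x k) := by
    rw [dotProduct, ← Finset.sum_add_distrib]
    refine Finset.sum_congr rfl fun i _ => ?_
    rw [HM_mulVec, phi]
    simp only [mul_sub, mul_add, add_mul, Finset.mul_sum, Finset.sum_mul, Finset.sum_sub_distrib]
    have e1 : ∀ k, x i * (Real.exp (-t i) * (W i k * Real.exp (t k)) * x i) =
      W i k * (Real.exp (-t i) * Real.exp (t k) * x i ^ 2) := fun k => by ring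
    have e2 : ∀ k, x i * (W i k * x k) = W i k * (x i * x k) := fun k => by ring
    simp only [e1, e2]
    ring
  have h2 : ∑ i, ∑ k, W i k * (Real.exp (-t i) * Real.exp (t k) * x i ^ 2 - x i * x k) =
      ∑ i, ∑ k, W i k * (Real.exp (-t k) * Real.exp (t i) * x k ^ 2 - x i * x k) := by
    rw [Finset.sum_comm]
    refine Finset.sum_congr rfl fun i _ => Finset.sum_congr rfl fun k _ => ?_
    rw [hW.apply, mul_comm (x k)]
  have h3 : 0 ≤ ∑ i, ∑ k, W i k * (Real.exp (-t i) * Real.exp (t k) * x i ^ 2 - x i * x k) +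
      ∑ i, ∑ k, W i k * (Real.exp (-t k) * Real.exp (t i) * x k ^ 2 - x i * x k) := by
    simp only [← Finset.sum_add_distrib, ← mul_add]
    refine Finset.sum_nonneg fun i _ => Finset.sum_nonneg fun k _ => mul_nonneg (hW0 i k) ?_
    rw [Real.exp_neg, Real.exp_neg]
    have : (Real.exp (t i))⁻¹ * Real.exp (t k) * x i ^ 2 - x i * x k +
      ((Real.exp (t k))⁻¹ * Real.exp (t i) * x k ^ 2 - x i * x k) =
      (Real.exp (t i) * Real.exp (t k))⁻¹ * (Real.exp (t k) * x i - Real.exp (t i) * x k) ^ 2 := by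
      field_simp
      ring
    rw [this]
    positivity
  have h4 : 0 < ∑ i, η i * Real.exp (-t i) * x i ^ 2 := by
    refine Finset.sum_pos' (fun i _ => ?_) ⟨i0, Finset.mem_univ _, ?_⟩
    · have := hη i
      positivity
    · have := hη i0
      have h5 : x i0 ≠ 0 := hi0
      positivity
  rw [h1]
  linarith

lemma phi_inv (W : Matrix ι ι ℝ) (hW : W.IsSymm)
    (hW0 : ∀ i k, 0 ≤ W i k) (η : ι → ℝ) (hη : ∀ i, 0 < η i) (t : ι → ℝ) :
    (HM W (phi W η t))⁻¹ *ᵥ η = fun i => Real.exp (t i) :=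
  pd_inv_eq (phi_pd W hW hW0 η hη t) (phi_solve W η t)

lemma phi_inj (W : Matrix ι ι ℝ) (hW : W.IsSymm)
    (hW0 : ∀ i k, 0 ≤ W i k) (η : ι → ℝ) (hη : ∀ i, 0 < η i) :
    Set.InjOn (phi W η) Set.univ := by
  intro t _ t2 _ h
  have h1 := phi_inv W hW hW0 η hη t
  rw [h, phi_inv W hW hW0 η hη t2] at h1
  ext i
  exact (Real.exp_injective (congrFun h1 i)).symm

lemma phi_image (W : Matrix ι ι ℝ) (hW : W.IsSymm)
    (hW0 : ∀ i k, 0 ≤ W i k) (η : ι → ℝ) (hη : ∀ i, 0 < η i) :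
    phi W η '' Set.univ = pdset W := by
  ext b
  constructor
  · rintro ⟨t, _, rfl⟩
    exact phi_pd W hW hW0 η hη t
  · intro hb
    have hx := pd_mul_inv (hb : (HM W b).PosDef) η
    set x := (HM W b)⁻¹ *ᵥ η
    have hpos := mmatrix_pos W hW0 b η hη hb x hx
    refine ⟨fun i => Real.log (x i), Set.mem_univ _, ?_⟩
    ext i
    have h1 := congrFun hx i
    rw [HM_mulVec] at h1
    have h2 := hpos i
    have h3 : ∀ k, Real.exp (Real.log (x k)) = x k := fun k => Real.exp_log (hpos k)
    simp only [phi, Real.exp_neg, h3, ← h1]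
    field_simp
    ring

lemma Jm_det (W : Matrix ι ι ℝ) (hW : W.IsSymm)
    (hW0 : ∀ i k, 0 ≤ W i k) (η : ι → ℝ) (hη : ∀ i, 0 < η i) (t : ι → ℝ) :
    |(Jm W η t).det| = (HM W (phi W η t)).det := by
  have hd := (phi_pd W hW hW0 η hη t).det_pos
  rw [Jm, det_neg, det_mul, det_mul, det_diagonal, det_diagonal, abs_mul, abs_pow, abs_neg, abs_one,
    one_pow, one_mul, mul_right_comm, ← Finset.prod_mul_distrib]
  simp only [← Real.exp_add, neg_add_cancel, Real.exp_zero, Finset.prod_const_one, one_mul]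
  exact abs_of_pos hd

lemma phi_deriv (W : Matrix ι ι ℝ) (η t : ι → ℝ) :
    HasFDerivAt (phi W η) (LinearMap.toContinuousLinearMap (Matrix.toLin' (Jm W η t))) t := by
  rw [hasFDerivAt_pi']
  intro i
  have hi : ∀ k, HasFDerivAt (fun t : ι → ℝ => t k)
      (ContinuousLinearMap.proj (R := ℝ) (φ := fun _ : ι => ℝ) k) t := fun k =>
    hasFDerivAt_apply k t
  have h1 := (hi i).neg.exp
  have h2 := (HasFDerivAt.fun_sum (u := Finset.univ)
    (fun k _ => ((hi k).exp.const_mul (W i k)))).const_add (η i)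
  have h3 := h1.mul h2
  refine h3.congr_fderiv ?_
  ext v
  have hJ : (Jm W η t *ᵥ v) i =
      -(Real.exp (-t i) * (phi W η t i * (Real.exp (t i) * v i) -
        ∑ k, W i k * (Real.exp (t k) * v k))) := by
    rw [Jm, neg_mulVec, Pi.neg_apply, ← mulVec_mulVec, ← mulVec_mulVec, mulVec_diagonal, HM_mulVec]
    simp only [mulVec_diagonal]
  have hp : phi W η t i * (Real.exp (t i) * v i) = (η i + ∑ k, W i k * Real.exp (t k)) * v i := by
    rw [phi, Real.exp_neg]
    field_simp
  rw [hp] at hJ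
  simp [toLin'_apply, hJ, ContinuousLinearMap.sum_apply]
  ring

lemma ward_t (W : Matrix ι ι ℝ) (hW : W.IsSymm)
    (hW0 : ∀ i k, 0 ≤ W i k) (η : ι → ℝ) (hη : ∀ i, 0 < η i) (j : ι) :
    ∫⁻ t : ι → ℝ, ENNReal.ofReal ((HM W (phi W η t)).det *
      (wt W η (phi W η t) * Real.exp (t j))) = ENNReal.ofReal √(2 * Real.pi) ^ (Fintype.card ι) := by
  rw [← ward_gen W hW hW0 η hη j, lintegral_indicator (pdset_meas W hW),
    ← phi_image W hW hW0 η hη,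
    lintegral_image_eq_lintegral_abs_det_fderiv_mul volume MeasurableSet.univ
      (fun t _ => (phi_deriv W η t).hasFDerivWithinAt) (phi_inj W hW hW0 η hη),
    Measure.restrict_univ]
  refine lintegral_congr fun t => ?_
  rw [LinearMap.det_toContinuousLinearMap, LinearMap.det_toLin', Jm_det W hW hW0 η hη,
    phi_inv W hW hW0 η hη, ENNReal.ofReal_mul (phi_pd W hW hW0 η hη t).det_pos.le]

end change

section torus
open Matrix

lemma NN_symm {L : ℕ} {x y : Torus L} (h : NN x y) : NN y x := by
  obtain ⟨hne, i, hi⟩ := h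
  refine ⟨hne.symm, i, ?_⟩
  rcases hi with rfl | rfl
  · right; simp
  · left; simp

/-- Coupling matrix of the torus. -/
def WT (L : ℕ) (β : ℝ) : Matrix (Torus L) (Torus L) ℝ :=
  Matrix.of fun x y => if NN x y then β else 0

lemma WT_symm (L : ℕ) (β : ℝ) : (WT L β).IsSymm := by
  ext x y
  have : NN y x ↔ NN x y := ⟨NN_symm, NN_symm⟩
  simp [WT, this]

lemma Dmat_eq {L : ℕ} [NeZero L] (β ε : ℝ) (t : Torus L → ℝ) :
    Dmat β ε t = diagonal (fun i => Real.exp (t i)) *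
      HM (WT L β) (phi (WT L β) (fun _ => ε) t) * diagonal (fun i => Real.exp (t i)) := by
  ext x y
  rw [mul_diagonal, diagonal_mul]
  by_cases hxy : x = y
  · subst hxy
    have hn : ¬ NN x x := fun h => h.1 rfl
    simp only [Dmat, HM, WT, phi, of_apply, if_true, Matrix.sub_apply, diagonal_apply_eq, hn, if_false,
      sub_zero]
    have h1 : β * (∑ i : Torus L, if NN i x then Real.exp (t i + t x) else 0) =
        (∑ k, (if NN x k then β else 0) * Real.exp (t k)) * Real.exp (t x) := by
      rw [Finset.mul_sum, Finset.sum_mul]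
      refine Finset.sum_congr rfl fun i _ => ?_
      have : NN i x ↔ NN x i := ⟨NN_symm, NN_symm⟩
      simp only [this]
      split_ifs
      · rw [Real.exp_add]; ring
      · ring
    rw [h1, Real.exp_neg]
    field_simp
    ring
  · simp only [Dmat, HM, WT, of_apply, hxy, if_false, Matrix.sub_apply, diagonal_apply_ne _ hxy]
    split_ifs
    · rw [Real.exp_add]; ring
    · ring

lemma Dmat_det {L : ℕ} [NeZero L] (β ε : ℝ) (t : Torus L → ℝ) :
    (Dmat β ε t).det = Real.exp (∑ i, t i) ^ 2 *
      (HM (WT L β) (phi (WT L β) (fun _ => ε) t)).det := by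
  rw [Dmat_eq, det_mul, det_mul, det_diagonal, ← Real.exp_sum]
  ring

lemma nn_energy {L : ℕ} [NeZero L] (β ε : ℝ) (t : Torus L → ℝ) :
    ∑ i, (phi (WT L β) (fun _ => ε) t i - ∑ k, WT L β i k) =
      2 * (β * nnSum (fun i j => Real.cosh (t i - t j) - 1)) + ∑ i, ε * Real.exp (-t i) := by
  have h1 : ∑ i, (phi (WT L β) (fun _ => ε) t i - ∑ k, WT L β i k) =
      ∑ i, ε * Real.exp (-t i) + ∑ i, ∑ k, WT L β i k * (Real.exp (t k - t i) - 1) := by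
    rw [← Finset.sum_add_distrib]
    refine Finset.sum_congr rfl fun i _ => ?_
    simp only [phi, mul_add, Finset.mul_sum, mul_sub, mul_one, Finset.sum_sub_distrib]
    have : ∀ k, Real.exp (-t i) * (WT L β i k * Real.exp (t k)) =
        WT L β i k * Real.exp (t k - t i) := fun k => by
      rw [sub_eq_add_neg, Real.exp_add]; ring
    simp only [this]
    ring
  have h2 : ∑ i, ∑ k, WT L β i k * (Real.exp (t k - t i) - 1) =
      ∑ i, ∑ k, WT L β i k * (Real.exp (t i - t k) - 1) := by
    rw [Finset.sum_comm]
    refine Finset.sum_congr rfl fun i _ => Finset.sum_congr rfl fun k _ => ?_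
    rw [(WT_symm L β).apply]
  have h3 : ∑ i, ∑ k, WT L β i k * (Real.exp (t k - t i) - 1) +
      ∑ i, ∑ k, WT L β i k * (Real.exp (t i - t k) - 1) =
      4 * (β * nnSum (fun i j => Real.cosh (t i - t j) - 1)) := by
    have : 4 * (β * nnSum (fun i j => Real.cosh (t i - t j) - 1)) =
        2 * β * ∑ x : Torus L, ∑ y : Torus L, if NN x y then Real.cosh (t x - t y) - 1 else 0 := by
      rw [nnSum]; ring
    rw [this]
    simp only [← Finset.sum_add_distrib, Finset.mul_sum]
    refine Finset.sum_congr rfl fun i _ => Finset.sum_congr rfl fun k _ => ?_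
    simp only [WT, of_apply]
    split_ifs
    · rw [Real.cosh_eq, neg_sub]; ring
    · ring
  rw [h1]
  linarith

lemma integrand_eq {L : ℕ} [NeZero L] (β ε : ℝ) (hβ : 0 < β) (hε : 0 < ε) (t : Torus L → ℝ) :
    Real.exp (-(freeEnergy β ε t)) = (HM (WT L β) (phi (WT L β) (fun _ => ε) t)).det *
      wt (WT L β) (fun _ => ε) (phi (WT L β) (fun _ => ε) t) := by
  have hW0 : ∀ i k, 0 ≤ WT L β i k := fun i k => by
    simp only [WT, of_apply]; split_ifs
    · exact hβ.le
    · exact le_rfl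
  have hd := (phi_pd (WT L β) (WT_symm L β) hW0 (fun _ => ε) (fun _ => hε) t).det_pos
  unfold wt
  rw [phi_inv (WT L β) (WT_symm L β) hW0 (fun _ => ε) (fun _ => hε) t, nn_energy]
  unfold freeEnergy
  rw [Dmat_det]
  set d := (HM (WT L β) (phi (WT L β) (fun _ => ε) t)).det
  rw [Real.log_mul (by positivity) hd.ne', Real.log_pow, Real.log_exp]
  have h1 : d * (Real.exp (-(1 / 2) * (2 * (β * nnSum (fun i j => Real.cosh (t i - t j) - 1)) +
      ∑ i, ε * Real.exp (-t i) + (fun _ : Torus L => ε) ⬝ᵥ (fun i => Real.exp (t i)) -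
      2 * ∑ _i : Torus L, ε)) / √d) = √d * Real.exp (-(1 / 2) *
      (2 * (β * nnSum (fun i j => Real.cosh (t i - t j) - 1)) +
      ∑ i, ε * Real.exp (-t i) + (fun _ : Torus L => ε) ⬝ᵥ (fun i => Real.exp (t i)) -
      2 * ∑ _i : Torus L, ε)) := by
    have hs : 0 < √d := Real.sqrt_pos.2 hd
    nth_rewrite 1 [← Real.mul_self_sqrt hd.le]
    field_simp
  rw [h1]
  have h2 : √d = Real.exp (1 / 2 * Real.log d) := by
    rw [← Real.exp_log (Real.sqrt_pos.2 hd), Real.log_sqrt hd.le]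
    ring_nf
  rw [h2, ← Real.exp_add]
  congr 1
  have h3 : ∑ k : Torus L, (t k - ε + ε * Real.cosh (t k)) = ∑ k, t k - ∑ _k : Torus L, ε +
      (1 / 2) * ((∑ i, ε * Real.exp (-t i)) + ∑ i, ε * Real.exp (t i)) := by
    rw [← Finset.sum_add_distrib, Finset.mul_sum, ← Finset.sum_sub_distrib,
      ← Finset.sum_add_distrib]
    refine Finset.sum_congr rfl fun i _ => ?_
    rw [Real.cosh_eq]; ring
  rw [h3, dotProduct]
  push_cast
  ring

lemma freeEnergy_meas {L : ℕ} [NeZero L] (β ε : ℝ) :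
    Measurable (freeEnergy (L := L) β ε) := by
  have hphi : Continuous (phi (WT L β) (fun _ => ε)) := by
    unfold phi; fun_prop
  have hdet : Measurable (fun t : Torus L → ℝ => (Dmat β ε t).det) := by
    have := (HM_continuous (WT L β)).comp hphi
    simp only [Dmat_det]
    refine Continuous.measurable ?_
    simp only [Function.comp_def] at this
    fun_prop
  have hnn : Measurable (fun t : Torus L → ℝ =>
      nnSum (fun i j => Real.cosh (t i - t j) - 1)) := by
    unfold nnSum
    refine Measurable.const_mul ?_ _
    refine Finset.measurable_sum _ fun i _ => Finset.measurable_sum _ fun k _ => ?_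
    split_ifs
    · fun_prop
    · fun_prop
  unfold freeEnergy
  refine ((hnn.const_mul _).sub (hdet.log.const_mul _)).add ?_
  fun_prop

end torus

/-- **Ward identity for the single-site exponential.** For every `β > 0`, `ε > 0`,
torus side `L ≥ 2` and site `j`, `⟨e^{t_j}⟩ = 1`. -/
theorem exp_ward_identity (β ε : ℝ) (hβ : 0 < β) (hε : 0 < ε) (L : ℕ)
    (j : Torus (L + 2)) :
    expect β ε (fun t => Real.exp (t j)) = 1 := by
  have hW0 : ∀ i k, 0 ≤ WT (L + 2) β i k := fun i k => by
    simp only [WT, Matrix.of_apply]; split_ifs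
    · exact hβ.le
    · exact le_rfl
  have key := ward_t (WT (L + 2) β) (WT_symm _ β) hW0 (fun _ => ε) (fun _ => hε) j
  have hF := freeEnergy_meas (L := L + 2) β ε
  have hc : (0 : ℝ) < √(2 * Real.pi) := Real.sqrt_pos.2 (by positivity)
  unfold expect
  rw [integral_mul_const, integral_eq_lintegral_of_nonneg_ae]
  · have h1 : ∫⁻ t : Torus (L + 2) → ℝ,
        ENNReal.ofReal (Real.exp (t j) * Real.exp (-(freeEnergy β ε t)))
        = ENNReal.ofReal √(2 * Real.pi) ^ (Fintype.card (Torus (L + 2))) := by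
      rw [← key]
      refine lintegral_congr fun t => ?_
      rw [integrand_eq β ε hβ hε t]
      congr 1
      ring
    rw [h1, ENNReal.toReal_pow, ENNReal.toReal_ofReal hc.le, ← mul_pow, mul_inv_cancel₀ hc.ne',
      one_pow]
  · exact Filter.Eventually.of_forall fun t => by positivity
  · refine Measurable.aestronglyMeasurable ?_
    exact (by fun_prop : Measurable fun t : Torus (L + 2) → ℝ => Real.exp (t j)).mul hF.neg.exp

end
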